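/- Let φ:ℝ→[0,1] be a smooth function with φ(x)=1 for |x|≤1 and φ(x)=0 for |x|≥2, and for R>0 set φ_R(x):=φ(x/R). There exists a constant C>0 (depending only on d0, L, and φ) such that for all a∈ℝ with a≠0 and all ε>0, taking R=min(|a|, sup_{s∈[0,L]}|D(s)|), one has |∫_{{s∈[0,L] : |D(s)|>ε}} e^{i a/(4 D(s))} · φ_R(D(s)) / |D(s)| ds| ≤ C / max(|a|,1). -/

import Mathlib

open MeasureTheory Set

/-- The reciprocal of an absolutely continuous function bounded away from zero is absolutely
continuous. -/
theorem AbsolutelyContinuousOnInterval.inv_of_le_abs {g : ℝ → ℝ} {p q δ : ℝ}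
    (hg : AbsolutelyContinuousOnInterval g p q) (hδ : 0 < δ)
    (hgδ : ∀ s ∈ uIcc p q, δ ≤ |g s|) :
    AbsolutelyContinuousOnInterval (fun s => (g s)⁻¹) p q := by
  rw [absolutelyContinuousOnInterval_iff] at hg ⊢
  intro ε hε
  obtain ⟨η, hη, h⟩ := hg (ε * δ ^ 2) (by positivity)
  refine ⟨η, hη, fun E hE hlen => ?_⟩
  have key := h E hE hlen
  have hle : ∑ i ∈ Finset.range E.1, dist (g (E.2 i).1)⁻¹ (g (E.2 i).2)⁻¹ ≤
      (∑ i ∈ Finset.range E.1, dist (g (E.2 i).1) (g (E.2 i).2)) / δ ^ 2 := by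
    rw [Finset.sum_div]
    refine Finset.sum_le_sum fun i hi => ?_
    have h1 := hgδ _ (hE.1 i hi).1
    have h2 := hgδ _ (hE.1 i hi).2
    have h1' : g (E.2 i).1 ≠ 0 := abs_pos.1 (hδ.trans_le h1)
    have h2' : g (E.2 i).2 ≠ 0 := abs_pos.1 (hδ.trans_le h2)
    rw [dist_inv_inv₀ h1' h2', Real.norm_eq_abs, Real.norm_eq_abs]
    gcongr
    nlinarith
  refine hle.trans_lt ?_
  rwa [div_lt_iff₀ (by positivity)]

/-- If `|∫₀ˣ k| ≤ M` for all `x`, then the integral of `k ∘ D` is controlled by `M`, provided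
the derivative `g` of `D` is absolutely continuous and bounded away from zero. -/
theorem abs_integral_comp_le_of_abs_primitive_le {k D g : ℝ → ℝ} {S : Set ℝ} {B M p q δ : ℝ}
    (hpq : p ≤ q) (hk : Measurable k) (hB : ∀ x, |k x| ≤ B) (hS : S.Countable)
    (hkS : ∀ x ∉ S, ContinuousAt k x) (hM : ∀ x, |∫ y in (0 : ℝ)..x, k y| ≤ M)
    (hD : ∀ x ∈ Icc p q, ∀ y ∈ Icc p q, D y - D x = ∫ t in x..y, g t)
    (hg : AbsolutelyContinuousOnInterval g p q) (hδ : 0 < δ)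
    (hgδ : ∀ s ∈ Icc p q, δ ≤ |g s|) :
    |∫ s in p..q, k (D s)| ≤ M * (2 / δ + ∫ s in p..q, |deriv (fun t => (g t)⁻¹) s|) := by
  have hu : uIcc p q = Icc p q := uIcc_of_le hpq
  have hgc : ContinuousOn g (Icc p q) := hu ▸ hg.continuousOn
  have hinv := hg.inv_of_le_abs hδ (hu ▸ hgδ)
  have hB0 : 0 ≤ B := (abs_nonneg _).trans (hB 0)
  have hki (x y : ℝ) : IntervalIntegrable k volume x y :=
    (intervalIntegrable_const (c := B)).mono_fun hk.aestronglyMeasurable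
      (Filter.Eventually.of_forall fun x => by
        simpa using (hB x).trans (le_abs_self B))
  obtain ⟨G, hG⟩ := hg.exists_bound
  rw [hu] at hG
  set F : ℝ → ℝ := fun s => ∫ y in (0 : ℝ)..D s, k y with hF
  have hderiv : ∀ s ∈ Ioo p q, HasDerivAt D (g s) s := by
    intro s hs
    have hgi : IntervalIntegrable g volume p s :=
      (hgc.mono (Icc_subset_Icc le_rfl hs.2.le)).intervalIntegrable_of_Icc hs.1.le
    have hnhds : Icc p q ∈ nhds s := Icc_mem_nhds hs.1 hs.2
    have h1 : HasDerivAt (fun x => ∫ t in p..x, g t) (g s) s :=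
      intervalIntegral.integral_hasDerivAt_right hgi
        (hgc.stronglyMeasurableAtFilter_nhdsWithin measurableSet_Icc s |>.filter_mono
          (by rw [nhdsWithin_eq_nhds.2 hnhds]))
        (hgc.continuousAt hnhds)
    refine (h1.const_add (D p)).congr_of_eventuallyEq ?_
    filter_upwards [hnhds] with x hx
    have := hD p ⟨le_rfl, hpq⟩ x hx
    linarith
  have hLip : ∀ x ∈ Icc p q, ∀ y ∈ Icc p q, |D y - D x| ≤ G * |y - x| := by
    intro x hx y hy
    rw [hD x hx y hy]
    exact intervalIntegral.norm_integral_le_of_norm_le_const fun t ht =>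
      hG t ((uIcc_subset_Icc hx hy) (uIoc_subset_uIcc ht))
  have hDc : ContinuousOn D (Icc p q) := by
    refine (LipschitzOnWith.of_dist_le_mul (K := G.toNNReal) fun x hx y hy => ?_).continuousOn
    rw [Real.dist_eq, Real.dist_eq]
    refine (hLip y hy x hx).trans ?_
    gcongr
    exact Real.le_coe_toNNReal G
  have hFac : AbsolutelyContinuousOnInterval F p q := by
    refine LipschitzOnWith.absolutelyContinuousOnInterval (K := (B * G).toNNReal) ?_
    refine LipschitzOnWith.of_dist_le_mul fun x hx y hy => ?_
    rw [hu] at hx hy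
    rw [Real.dist_eq, Real.dist_eq, hF]
    simp only
    rw [intervalIntegral.integral_interval_sub_left (hki _ _) (hki _ _)]
    have h1 : ‖∫ t in D y..D x, k t‖ ≤ B * |D x - D y| :=
      intervalIntegral.norm_integral_le_of_norm_le_const fun t _ => hB t
    calc |∫ t in D y..D x, k t| ≤ B * |D x - D y| := h1
      _ ≤ B * (G * |x - y|) := by gcongr; exact hLip y hy x hx
      _ = B * G * |x - y| := by ring
      _ ≤ (B * G).toNNReal * |x - y| := by gcongr; exact Real.le_coe_toNNReal _
  have hinj : InjOn D (Icc p q) := by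
    have hlt : ∀ x ∈ Icc p q, ∀ y ∈ Icc p q, x < y → D x ≠ D y := by
      intro x hx y hy hxy hne
      obtain ⟨z, hz, hz0⟩ := exists_hasDerivAt_eq_zero hxy (hDc.mono (Icc_subset_Icc hx.1 hy.2))
        hne (fun z hz => hderiv z ⟨hx.1.trans_lt hz.1, hz.2.trans_le hy.2⟩)
      have := hgδ z ⟨hx.1.trans hz.1.le, hz.2.le.trans hy.2⟩
      rw [hz0, abs_zero] at this
      linarith
    intro x hx y hy hxy
    rcases lt_trichotomy x y with h | h | h
    · exact absurd hxy (hlt x hx y hy h)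
    · exact h
    · exact absurd hxy.symm (hlt y hy x hx h)
  have hcount : (Icc p q ∩ D ⁻¹' S).Countable := by
    refine MapsTo.countable_of_injOn (f := D) (t := S) (fun x hx => hx.2)
      (hinj.mono inter_subset_left) hS
  have hae : ∀ᵐ s, s ∈ uIoc p q → k (D s) = (g s)⁻¹ * deriv F s := by
    filter_upwards [hcount.ae_notMem volume, (Set.countable_singleton q).ae_notMem volume]
      with s hs hsq hsI
    rw [uIoc_of_le hpq] at hsI
    have hsI' : s ∈ Ioo p q := ⟨hsI.1, lt_of_le_of_ne hsI.2 hsq⟩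
    have hsS : D s ∉ S := fun h => hs ⟨⟨hsI.1.le, hsI.2⟩, h⟩
    have h1 : HasDerivAt (fun x => ∫ y in (0 : ℝ)..x, k y) (k (D s)) (D s) :=
      intervalIntegral.integral_hasDerivAt_right (hki _ _)
        (hk.stronglyMeasurable.stronglyMeasurableAtFilter) (hkS _ hsS)
    have h2 : deriv F s = k (D s) * g s := (h1.comp s (hderiv s hsI')).deriv
    have h3 : g s ≠ 0 := abs_pos.1 (hδ.trans_le (hgδ s ⟨hsI.1.le, hsI.2⟩))
    rw [h2]
    field_simp
  have hinvle : ∀ s ∈ Icc p q, |(g s)⁻¹| ≤ 1 / δ := by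
    intro s hs
    rw [abs_inv, ← one_div]
    exact one_div_le_one_div_of_le hδ (hgδ s hs)
  have hFM : ∀ s, |F s| ≤ M := fun s => hM _
  have hM0 : 0 ≤ M := (abs_nonneg _).trans (hM 0)
  have hint : |∫ x in p..q, deriv (fun t => (g t)⁻¹) x * F x| ≤
      M * ∫ s in p..q, |deriv (fun t => (g t)⁻¹) s| := by
    rw [← intervalIntegral.integral_const_mul]
    refine (intervalIntegral.abs_integral_le_integral_abs hpq).trans ?_
    refine intervalIntegral.integral_mono_on hpq ?_ ?_ ?_
    · exact (hinv.intervalIntegrable_deriv.mul_continuousOn hFac.continuousOn).abs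
    · exact hinv.intervalIntegrable_deriv.abs.const_mul _
    · intro x _
      rw [abs_mul, mul_comm]
      gcongr
      exact hFM x
  rw [intervalIntegral.integral_congr_ae hae, hinv.integral_mul_deriv_eq_deriv_mul hFac]
  have hb (s) (hs : s ∈ Icc p q) : |(g s)⁻¹ * F s| ≤ M / δ := by
    rw [abs_mul]
    calc _ ≤ 1 / δ * M := by gcongr; exacts [hinvle s hs, hFM s]
      _ = M / δ := by ring
  have e1 := hb q ⟨hpq, le_rfl⟩
  have e2 := hb p ⟨le_rfl, hpq⟩
  calc _ ≤ |(g q)⁻¹ * F q| + |(g p)⁻¹ * F p| + |∫ x in p..q, deriv (fun t => (g t)⁻¹) x * F x| :=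
        (abs_sub _ _).trans (by gcongr; exact abs_sub _ _)
    _ ≤ M / δ + M / δ + M * ∫ s in p..q, |deriv (fun t => (g t)⁻¹) s| := by gcongr
    _ = _ := by ring

/-- The oscillatory kernel `e^{ia/(4x)} ψ(x/R)/|x|`, set to zero for `|x| ≤ ε`. -/
noncomputable def truncatedKernel (ψ : ℝ → ℝ) (a R ε x : ℝ) : ℂ :=
  {x | ε < |x|}.indicator
    (fun x : ℝ => Complex.exp (Complex.I * a / (4 * x)) * ((ψ (x / R) / |x| : ℝ) : ℂ)) x

theorem truncatedKernel_of_lt (ψ : ℝ → ℝ) (a R : ℝ) {ε x : ℝ} (h : ε < |x|) :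
    truncatedKernel ψ a R ε x =
      Complex.exp (Complex.I * a / (4 * x)) * ((ψ (x / R) / |x| : ℝ) : ℂ) :=
  indicator_of_mem (s := {x : ℝ | ε < |x|}) h _

theorem truncatedKernel_of_le (ψ : ℝ → ℝ) (a R : ℝ) {ε x : ℝ} (h : |x| ≤ ε) :
    truncatedKernel ψ a R ε x = 0 :=
  indicator_of_notMem (s := {x : ℝ | ε < |x|}) h.not_gt _

theorem norm_cexp_I_mul_div (a x : ℝ) : ‖Complex.exp (Complex.I * a / (4 * x))‖ = 1 := by
  have : Complex.I * a / (4 * x) = ((a / (4 * x) : ℝ) : ℂ) * Complex.I := by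
    push_cast; ring
  rw [this, Complex.norm_exp_ofReal_mul_I]

theorem measurable_truncatedKernel {ψ : ℝ → ℝ} (hψ : Continuous ψ) (a R ε : ℝ) :
    Measurable (truncatedKernel ψ a R ε) := by
  have := hψ.measurable
  refine Measurable.indicator ?_ (measurableSet_lt measurable_const measurable_id.abs)
  fun_prop

theorem norm_truncatedKernel_le {ψ : ℝ → ℝ} (hψ : ∀ x, ψ x ∈ Icc (0 : ℝ) 1) (a R : ℝ) {ε : ℝ}
    (hε : 0 < ε) (x : ℝ) : ‖truncatedKernel ψ a R ε x‖ ≤ 1 / ε := by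
  rw [truncatedKernel, indicator]
  split_ifs with h
  · have h' : ε < |x| := h
    rw [norm_mul, norm_cexp_I_mul_div, one_mul, Complex.norm_real, Real.norm_eq_abs, abs_div,
      abs_abs, abs_of_nonneg (hψ _).1]
    exact div_le_div₀ zero_le_one (hψ _).2 hε h'.le
  · rw [norm_zero]; positivity

theorem continuousAt_truncatedKernel {ψ : ℝ → ℝ} (hψ : Continuous ψ) (a R : ℝ) {ε x : ℝ}
    (hε : 0 < ε) (hx : x ∉ ({ε, -ε} : Set ℝ)) : ContinuousAt (truncatedKernel ψ a R ε) x := by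
  have hne : |x| ≠ ε := fun h => hx (by
    rcases eq_or_eq_neg_of_abs_eq h with h | h <;> simp [h])
  rcases lt_or_gt_of_ne hne with h | h
  · refine (continuousAt_const (y := (0 : ℂ))).congr ?_
    filter_upwards [continuous_abs.continuousAt.eventually_lt continuousAt_const h] with y hy
    exact (truncatedKernel_of_le ψ a R hy.le).symm
  · have hx0 : x ≠ 0 := abs_pos.1 (hε.trans h)
    have hx0' : (4 * (x : ℂ)) ≠ 0 := by simpa using hx0
    have hc : ContinuousAt (fun x : ℝ =>
        Complex.exp (Complex.I * a / (4 * x)) * ((ψ (x / R) / |x| : ℝ) : ℂ)) x := by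
      refine ContinuousAt.mul ?_ ?_
      · fun_prop (disch := assumption)
      · refine Complex.continuous_ofReal.continuousAt.comp ?_
        exact ContinuousAt.div (by fun_prop) (by fun_prop) (abs_pos.2 hx0).ne'
    refine hc.congr ?_
    filter_upwards [continuousAt_const.eventually_lt continuous_abs.continuousAt h] with y hy
    exact (truncatedKernel_of_lt ψ a R hy).symm

theorem intervalIntegrable_truncatedKernel {ψ : ℝ → ℝ} (hψ : Continuous ψ)
    (hψr : ∀ x, ψ x ∈ Icc (0 : ℝ) 1) (a R : ℝ) {ε : ℝ} (hε : 0 < ε) (p q : ℝ) :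
    IntervalIntegrable (truncatedKernel ψ a R ε) volume p q :=
  (intervalIntegrable_const (c := 1 / ε)).mono_fun
    (measurable_truncatedKernel hψ a R ε).aestronglyMeasurable
    (Filter.Eventually.of_forall fun x => by
      simpa using (norm_truncatedKernel_le hψr a R hε x).trans (le_abs_self _))

/-- Integration by parts gains a factor `R / |a|` on the support of the cutoff. -/
theorem norm_integral_oscillatory_le {ψ : ℝ → ℝ} (hψ : ContDiff ℝ 1 ψ) {B a R p q : ℝ}
    (hψr : ∀ x, ψ x ∈ Icc (0 : ℝ) 1) (hB : ∀ t ∈ Icc (0 : ℝ) 2, |ψ t + t * deriv ψ t| ≤ B)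
    (ha : a ≠ 0) (hp : 0 < p) (hpq : p ≤ q) (hq : q ≤ 2 * R) :
    ‖∫ y in p..q, Complex.exp (Complex.I * a / (4 * y)) * ((ψ (y / R) / |y| : ℝ) : ℂ)‖ ≤
      (16 + 8 * B) * (R / |a|) := by
  have hR : 0 < R := by linarith
  have hB0 : 0 ≤ B := (abs_nonneg _).trans (hB 0 (by simp))
  have ha' : (a : ℂ) ≠ 0 := by exact_mod_cast ha
  have hu : uIcc p q = Icc p q := uIcc_of_le hpq
  set u : ℝ → ℂ := fun y => (4 * Complex.I / a) * ((y * ψ (y / R) : ℝ) : ℂ) with hu_def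
  set u' : ℝ → ℂ := fun y =>
    (4 * Complex.I / a) * ((ψ (y / R) + y / R * deriv ψ (y / R) : ℝ) : ℂ) with hu'_def
  set v : ℝ → ℂ := fun y => Complex.exp (Complex.I * a / (4 * y)) with hv_def
  set v' : ℝ → ℂ := fun y => v y * (-(Complex.I * a) / (4 * (y : ℂ) ^ 2)) with hv'_def
  have hdψ : Continuous (deriv ψ) := hψ.continuous_deriv le_rfl
  have hcψ : Continuous ψ := hψ.continuous
  have hu1 : ∀ x ∈ uIcc p q, HasDerivAt u (u' x) x := by
    intro x _
    have h1 : HasDerivAt (fun y => ψ (y / R)) (deriv ψ (x / R) * (1 / R)) x :=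
      ((hψ.differentiable one_ne_zero) (x / R)).hasDerivAt.comp x ((hasDerivAt_id x).div_const R)
    have h2 := ((hasDerivAt_id x).mul h1).ofReal_comp.const_mul (4 * Complex.I / (a : ℂ))
    convert! h2 using 1
    simp only [hu'_def, id]
    congr 2
    ring
  have hv1 : ∀ x ∈ uIcc p q, HasDerivAt v (v' x) x := by
    intro x hx
    rw [hu] at hx
    have hx0 : (x : ℂ) ≠ 0 := by exact_mod_cast (hp.trans_le hx.1).ne'
    have h1 : HasDerivAt (fun y : ℝ => (y : ℂ)) 1 x := (hasDerivAt_id x).ofReal_comp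
    have h2 := ((hasDerivAt_const x (Complex.I * a)).div (h1.const_mul (4 : ℂ))
      (mul_ne_zero (by norm_num) hx0)).cexp
    convert! h2 using 1
    simp only [hv'_def, hv_def]
    congr 1
    simp only [zero_mul, mul_one]
    field_simp
    ring
  have hcu' : Continuous u' := by
    have : Continuous fun y => ψ (y / R) + y / R * deriv ψ (y / R) := by fun_prop
    exact continuous_const.mul (Complex.continuous_ofReal.comp this)
  have hv'c : ContinuousOn v' (uIcc p q) := by
    have hvc : ContinuousOn v (uIcc p q) := fun x hx => (hv1 x hx).continuousAt.continuousWithinAt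
    refine hvc.mul (ContinuousOn.div (by fun_prop) (by fun_prop) fun x hx => ?_)
    rw [hu] at hx
    have hx0 : (x : ℂ) ≠ 0 := by exact_mod_cast (hp.trans_le hx.1).ne'
    exact mul_ne_zero (by norm_num) (pow_ne_zero _ hx0)
  have hcongr : ∫ y in p..q, Complex.exp (Complex.I * a / (4 * y)) *
      ((ψ (y / R) / |y| : ℝ) : ℂ) = ∫ y in p..q, u y * v' y := by
    refine intervalIntegral.integral_congr fun x hx => ?_
    rw [hu] at hx
    have hxp := hp.trans_le hx.1
    have hx0 : (x : ℂ) ≠ 0 := by exact_mod_cast hxp.ne'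
    simp only [hu_def, hv'_def, hv_def, abs_of_pos hxp]
    push_cast
    field_simp
    rw [Complex.I_sq]
    ring
  have hvn (x : ℝ) : ‖v x‖ = 1 := norm_cexp_I_mul_div a x
  have hc : ‖4 * Complex.I / (a : ℂ)‖ = 4 / |a| := by simp
  have hub : ∀ x ∈ Icc p q, ‖u x * v x‖ ≤ 4 / |a| * (2 * R) := by
    intro x hx
    have hxp := hp.trans_le hx.1
    rw [norm_mul, hvn, mul_one, hu_def, norm_mul, hc, Complex.norm_real, Real.norm_eq_abs, abs_mul,
      abs_of_pos hxp, abs_of_nonneg (hψr _).1]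
    refine mul_le_mul_of_nonneg_left ?_ (by positivity)
    nlinarith [(hψr (x / R)).1, (hψr (x / R)).2, hx.2]
  have hint : ‖∫ x in p..q, u' x * v x‖ ≤ 4 / |a| * B * (2 * R) := by
    calc _ ≤ 4 / |a| * B * |q - p| := by
          refine intervalIntegral.norm_integral_le_of_norm_le_const fun x hx => ?_
          rw [uIoc_of_le hpq] at hx
          rw [norm_mul, hvn, mul_one, hu'_def, norm_mul, hc, Complex.norm_real, Real.norm_eq_abs]
          gcongr
          refine hB _ ⟨(div_pos (hp.trans hx.1) hR).le, ?_⟩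
          rw [div_le_iff₀ hR]
          linarith [hx.2]
      _ ≤ _ := by
        gcongr
        rw [abs_of_nonneg (by linarith)]
        linarith
  rw [hcongr, intervalIntegral.integral_mul_deriv_eq_deriv_mul hu1 hv1
    (hcu'.intervalIntegrable _ _) hv'c.intervalIntegrable]
  calc _ ≤ ‖u q * v q‖ + ‖u p * v p‖ + ‖∫ x in p..q, u' x * v x‖ :=
        (norm_sub_le _ _).trans (by gcongr; exact norm_sub_le _ _)
    _ ≤ 4 / |a| * (2 * R) + 4 / |a| * (2 * R) + 4 / |a| * B * (2 * R) := by
      gcongr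
      exacts [hub q ⟨hpq, le_rfl⟩, hub p ⟨le_rfl, hpq⟩]
    _ = _ := by ring

theorem norm_integral_truncatedKernel_le_of_nonneg {ψ : ℝ → ℝ} (hψ : ContDiff ℝ 1 ψ)
    {B a R ε x : ℝ} (hψr : ∀ x, ψ x ∈ Icc (0 : ℝ) 1) (hψ0 : ∀ x, 2 ≤ |x| → ψ x = 0)
    (hB : ∀ t ∈ Icc (0 : ℝ) 2, |ψ t + t * deriv ψ t| ≤ B)
    (ha : a ≠ 0) (hR : 0 < R) (hε : 0 < ε) (hx : 0 ≤ x) :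
    ‖∫ y in (0 : ℝ)..x, truncatedKernel ψ a R ε y‖ ≤ (16 + 8 * B) * (R / |a|) := by
  have hB0 : 0 ≤ B := (abs_nonneg _).trans (hB 0 (by simp))
  have hpos : 0 ≤ (16 + 8 * B) * (R / |a|) := by positivity
  have hi := intervalIntegrable_truncatedKernel hψ.continuous hψr a R hε
  have hlow (x : ℝ) (h0 : 0 ≤ x) (hxε : x ≤ ε) :
      ∫ y in (0 : ℝ)..x, truncatedKernel ψ a R ε y = 0 := by
    refine intervalIntegral.integral_zero_ae (Filter.Eventually.of_forall fun y hy => ?_)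
    rw [uIoc_of_le h0] at hy
    exact truncatedKernel_of_le ψ a R (by rw [abs_of_pos hy.1]; exact hy.2.trans hxε)
  have hhigh (x : ℝ) (hRx : 2 * R ≤ x) : ∫ y in (2 * R)..x, truncatedKernel ψ a R ε y = 0 := by
    refine intervalIntegral.integral_zero_ae (Filter.Eventually.of_forall fun y hy => ?_)
    rw [uIoc_of_le hRx] at hy
    have : ψ (y / R) = 0 := hψ0 _ (by
      rw [abs_div, abs_of_pos hR, le_div_iff₀ hR]; exact hy.1.le.trans (le_abs_self _))
    simp [truncatedKernel, indicator, this]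
  have hmid (x : ℝ) (h0 : 0 ≤ x) (hxR : x ≤ 2 * R) :
      ‖∫ y in (0 : ℝ)..x, truncatedKernel ψ a R ε y‖ ≤ (16 + 8 * B) * (R / |a|) := by
    rcases le_total x ε with h | h
    · rw [hlow x h0 h, norm_zero]; exact hpos
    · rw [← intervalIntegral.integral_add_adjacent_intervals (hi 0 ε) (hi ε x),
        hlow ε hε.le le_rfl, zero_add]
      have : ∫ y in ε..x, truncatedKernel ψ a R ε y = ∫ y in ε..x,
          Complex.exp (Complex.I * a / (4 * y)) * ((ψ (y / R) / |y| : ℝ) : ℂ) := by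
        refine intervalIntegral.integral_congr_ae (Filter.Eventually.of_forall fun y hy => ?_)
        rw [uIoc_of_le h] at hy
        exact truncatedKernel_of_lt ψ a R (hy.1.trans_le (le_abs_self _))
      rw [this]
      exact norm_integral_oscillatory_le hψ hψr hB ha hε h hxR
  rcases le_total x (2 * R) with h | h
  · exact hmid x hx h
  · rw [← intervalIntegral.integral_add_adjacent_intervals (hi 0 (2 * R)) (hi _ x), hhigh x h,
      add_zero]
    exact hmid _ (by positivity) le_rfl

theorem truncatedKernel_neg (ψ : ℝ → ℝ) (a R ε x : ℝ) :
    truncatedKernel ψ a R ε (-x) = truncatedKernel (fun t => ψ (-t)) (-a) R ε x := by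
  simp only [truncatedKernel, indicator, mem_ofPred_eq, abs_neg, neg_div, Complex.ofReal_neg,
    mul_neg, div_neg]

theorem exists_norm_integral_truncatedKernel_le {φ : ℝ → ℝ} (hφ : ContDiff ℝ 1 φ)
    (hφr : ∀ x, φ x ∈ Icc (0 : ℝ) 1) (hφ0 : ∀ x, 2 ≤ |x| → φ x = 0) :
    ∃ C : ℝ, ∀ a R ε : ℝ, a ≠ 0 → 0 < R → 0 < ε → ∀ x : ℝ,
      ‖∫ y in (0 : ℝ)..x, truncatedKernel φ a R ε y‖ ≤ C * (R / |a|) := by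
  have key (ψ : ℝ → ℝ) (hψ : ContDiff ℝ 1 ψ) :
      ∃ B, ∀ t ∈ Icc (0 : ℝ) 2, |ψ t + t * deriv ψ t| ≤ B := by
    have hd := hψ.continuous_deriv le_rfl
    have hc := hψ.continuous
    exact isCompact_Icc.exists_bound_of_continuousOn
      (f := fun t => ψ t + t * deriv ψ t) (by fun_prop)
  have hφn : ContDiff ℝ 1 fun t => φ (-t) := hφ.comp contDiff_neg
  obtain ⟨B₁, hB₁⟩ := key φ hφ
  obtain ⟨B₂, hB₂⟩ := key _ hφn
  refine ⟨16 + 8 * max B₁ B₂, fun a R ε ha hR hε x => ?_⟩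
  rcases le_total 0 x with hx | hx
  · exact norm_integral_truncatedKernel_le_of_nonneg hφ hφr hφ0
      (fun t ht => (hB₁ t ht).trans (le_max_left _ _)) ha hR hε hx
  · have h := norm_integral_truncatedKernel_le_of_nonneg (B := max B₁ B₂) hφn (fun t => hφr _)
      (fun t ht => hφ0 _ (by rwa [abs_neg]))
      (fun t ht => (hB₂ t ht).trans (le_max_right _ _)) (neg_ne_zero.2 ha) hR hε
      (neg_nonneg.2 hx)
    simp_rw [← truncatedKernel_neg] at h
    rw [intervalIntegral.integral_comp_neg, neg_neg, neg_zero, intervalIntegral.integral_symm,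
      norm_neg, abs_neg] at h
    exact h

/-- A function which agrees a.e. on an open interval with a primitive of an integrable function and
is a.e. bounded away from zero has an absolutely continuous representative on the closed interval,
bounded away from zero everywhere. -/
theorem exists_absolutelyContinuous_representative {d g g' : ℝ → ℝ} {p q δ : ℝ} (hpq : p < q)
    (hg' : IntegrableOn g' (Ioo p q))
    (hgg' : ∀ x ∈ Ioo p q, ∀ y ∈ Ioo p q, g y - g x = ∫ t in x..y, g' t)
    (hdg : ∀ᵐ s ∂(volume.restrict (Ioo p q)), d s = g s)
    (hdδ : ∀ᵐ s ∂(volume.restrict (Ioo p q)), δ ≤ |d s|) :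
    ∃ G : ℝ → ℝ, AbsolutelyContinuousOnInterval G p q ∧ (∀ s ∈ Icc p q, δ ≤ |G s|) ∧
      ∀ᵐ s ∂(volume.restrict (Icc p q)), d s = G s := by
  obtain ⟨m, hm⟩ := nonempty_Ioo.2 hpq
  have hint : IntervalIntegrable g' volume p q :=
    (intervalIntegrable_iff_integrableOn_Ioo_of_le hpq.le).2 hg'
  have hu : uIcc p q = Icc p q := uIcc_of_le hpq.le
  set G : ℝ → ℝ := fun s => g m + ∫ t in m..s, g' t with hG
  have hGac : AbsolutelyContinuousOnInterval G p q := by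
    have h1 := hint.absolutelyContinuousOnInterval_intervalIntegral (c := m)
      (hu ▸ Ioo_subset_Icc_self hm)
    have h2 : AbsolutelyContinuousOnInterval (fun _ : ℝ => g m) p q :=
      (LipschitzWith.const (g m)).lipschitzOnWith.absolutelyContinuousOnInterval
    exact h2.fun_add h1
  have hGc : ContinuousOn G (Icc p q) := hu ▸ hGac.continuousOn
  have hdG : ∀ᵐ s ∂(volume.restrict (Ioo p q)), d s = G s := by
    filter_upwards [hdg, ae_restrict_mem measurableSet_Ioo] with s hs hsI
    rw [hs, hG]
    simp only
    rw [← hgg' m hm s hsI]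
    ring
  have hmin : (fun s => min |G s| δ) =ᵐ[volume.restrict (Icc p q)] fun _ => δ := by
    rw [← restrict_Ioo_eq_restrict_Icc]
    filter_upwards [hdG, hdδ] with s h1 h2
    exact min_eq_right (h1 ▸ h2)
  have hEq := Measure.eqOn_Icc_of_ae_eq volume hpq.ne hmin (hGc.abs.inf continuousOn_const)
    continuousOn_const
  refine ⟨G, hGac, fun s hs => min_eq_right_iff.1 (hEq hs), ?_⟩
  rwa [← restrict_Ioo_eq_restrict_Icc]

/-- If `|∫₀ˣ k| ≤ M` for all `x`, then a complex-valued kernel `k` composed with `D` has integral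
controlled by `M`. -/
theorem norm_integral_comp_le_of_norm_primitive_le {k : ℝ → ℂ} {D g : ℝ → ℝ} {S : Set ℝ}
    {B M p q δ : ℝ}
    (hpq : p ≤ q) (hk : Measurable k) (hB : ∀ x, ‖k x‖ ≤ B) (hS : S.Countable)
    (hkS : ∀ x ∉ S, ContinuousAt k x) (hM : ∀ x, ‖∫ y in (0 : ℝ)..x, k y‖ ≤ M)
    (hDc : ContinuousOn D (Icc p q))
    (hD : ∀ x ∈ Icc p q, ∀ y ∈ Icc p q, D y - D x = ∫ t in x..y, g t)
    (hg : AbsolutelyContinuousOnInterval g p q) (hδ : 0 < δ)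
    (hgδ : ∀ s ∈ Icc p q, δ ≤ |g s|) :
    IntervalIntegrable (fun s => k (D s)) volume p q ∧ ‖∫ s in p..q, k (D s)‖ ≤
      2 * (2 / δ + ∫ s in p..q, |deriv (fun t => (g t)⁻¹) s|) * M := by
  have hki (x y : ℝ) : IntervalIntegrable k volume x y :=
    (intervalIntegrable_const (c := B)).mono_fun hk.aestronglyMeasurable
      (Filter.Eventually.of_forall fun x => by
        simpa using (hB x).trans (le_abs_self B))
  have hkD : IntervalIntegrable (fun s => k (D s)) volume p q := by
    refine (intervalIntegrable_const (c := B)).mono_fun ?_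
      (Filter.Eventually.of_forall fun x => by
        simpa using (hB (D x)).trans (le_abs_self B))
    rw [uIoc_of_le hpq]
    exact (hk.comp_aemeasurable ((hDc.mono Ioc_subset_Icc_self).aemeasurable
      measurableSet_Ioc)).aestronglyMeasurable
  have hre := abs_integral_comp_le_of_abs_primitive_le (k := fun x => (k x).re) (B := B) (M := M)
    hpq (Complex.measurable_re.comp hk) (fun x => (Complex.abs_re_le_norm _).trans (hB x)) hS
    (fun x hx => Complex.continuous_re.continuousAt.comp (hkS x hx))
    (fun x => by
      have := Complex.reCLM.intervalIntegral_comp_comm (hki 0 x)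
      simp only [Complex.reCLM_apply] at this
      rw [this]
      exact (Complex.abs_re_le_norm _).trans (hM x)) hD hg hδ hgδ
  have him := abs_integral_comp_le_of_abs_primitive_le (k := fun x => (k x).im) (B := B) (M := M)
    hpq (Complex.measurable_im.comp hk) (fun x => (Complex.abs_im_le_norm _).trans (hB x)) hS
    (fun x hx => Complex.continuous_im.continuousAt.comp (hkS x hx))
    (fun x => by
      have := Complex.imCLM.intervalIntegral_comp_comm (hki 0 x)
      simp only [Complex.imCLM_apply] at this
      rw [this]
      exact (Complex.abs_im_le_norm _).trans (hM x)) hD hg hδ hgδ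
  have hre' := Complex.reCLM.intervalIntegral_comp_comm hkD
  have him' := Complex.imCLM.intervalIntegral_comp_comm hkD
  simp only [Complex.reCLM_apply, Complex.imCLM_apply] at hre' him'
  rw [hre'] at hre
  rw [him'] at him
  refine ⟨hkD, (Complex.norm_le_abs_re_add_abs_im _).trans ((add_le_add hre him).trans_eq ?_)⟩
  ring

/-- If `d0` is piecewise `W^{1,1}` and bounded away from zero on `[0, L]`, then
the regularized oscillatory integral
`∫_{|D| > ε} e^{-ia/(4D(s))} φ_R(D(s))/|D(s)| ds` is bounded by `C·R/|a|`. -/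
theorem oscillatory_small_D_bound
    (L : ℝ) (hL : 0 < L) (d0 : ℝ → ℝ)
    (hd0int : IntegrableOn d0 (Icc 0 L))
    (D : ℝ → ℝ) (hD : ∀ s, D s = ∫ t in (0:ℝ)..s, d0 t)
    (hbdd : ∃ δ > (0:ℝ), ∀ᵐ s ∂(volume.restrict (Icc (0:ℝ) L)), δ ≤ |d0 s|)
    (hpw : ∃ N : ℕ, 0 < N ∧ ∃ c : ℕ → ℝ,
      c 0 = 0 ∧ c N = L ∧ (∀ j < N, c j < c (j + 1)) ∧
      (∀ j < N, ∃ g g' : ℝ → ℝ,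
        IntegrableOn g' (Ioo (c j) (c (j + 1))) ∧
        (∀ x ∈ Ioo (c j) (c (j + 1)), ∀ y ∈ Ioo (c j) (c (j + 1)),
          g y - g x = ∫ t in x..y, g' t) ∧
        (∀ᵐ s ∂(volume.restrict (Ioo (c j) (c (j + 1)))), d0 s = g s)))
    (φ : ℝ → ℝ) (hφsmooth : ContDiff ℝ (⊤ : ℕ∞) φ) (hφrange : ∀ x, φ x ∈ Icc (0:ℝ) 1)
    (hφone : ∀ x : ℝ, |x| ≤ 1 → φ x = 1) (hφzero : ∀ x : ℝ, 2 ≤ |x| → φ x = 0) :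
    ∃ C > (0:ℝ), ∀ a : ℝ, a ≠ 0 → ∀ ε > (0:ℝ),
      ‖∫ s in {s ∈ Icc (0:ℝ) L | ε < |D s|},
          Complex.exp (Complex.I * a / (4 * D s)) *
            ((φ (D s / min |a| (sSup ((fun s => |D s|) '' Icc (0:ℝ) L))) / |D s| : ℝ) : ℂ)‖
        ≤ C / max |a| 1 := by
  obtain ⟨δ, hδ, hdδ⟩ := hbdd
  obtain ⟨N, hN, c, hc0, hcN, hclt, hpw⟩ := hpw
  have hcmono : ∀ i ≤ N, ∀ j ≤ i, c j ≤ c i := by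
    intro i hi j hji
    induction i, hji using Nat.le_induction with
    | base => exact le_rfl
    | succ i _ ih => exact (ih (by omega)).trans (hclt i (by omega)).le
  have hsub : ∀ j < N, Icc (c j) (c (j + 1)) ⊆ Icc 0 L := fun j hj =>
    Icc_subset_Icc (hc0 ▸ hcmono j hj.le 0 (Nat.zero_le _)) (hcN ▸ hcmono N le_rfl (j + 1) hj)
  have hDint : ∀ x ∈ Icc 0 L, ∀ y ∈ Icc 0 L, D y - D x = ∫ t in x..y, d0 t := by
    have hii : ∀ x ∈ Icc 0 L, IntervalIntegrable d0 volume 0 x := fun x hx =>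
      (intervalIntegrable_iff_integrableOn_Icc_of_le hx.1).2
        (hd0int.mono_set (Icc_subset_Icc le_rfl hx.2))
    intro x hx y hy
    rw [hD, hD, intervalIntegral.integral_interval_sub_left (hii y hy) (hii x hx)]
  have hDc : ContinuousOn D (Icc 0 L) := by
    have := intervalIntegral.continuousOn_primitive_interval (a := 0) (b := L) (f := d0)
      (μ := volume) (by rwa [uIcc_of_le hL.le])
    rw [uIcc_of_le hL.le] at this
    exact this.congr fun x _ => hD x
  have hpiece : ∀ j < N, ∃ G : ℝ → ℝ, AbsolutelyContinuousOnInterval G (c j) (c (j + 1)) ∧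
      (∀ s ∈ Icc (c j) (c (j + 1)), δ ≤ |G s|) ∧
      ∀ x ∈ Icc (c j) (c (j + 1)), ∀ y ∈ Icc (c j) (c (j + 1)),
        D y - D x = ∫ t in x..y, G t := by
    intro j hj
    obtain ⟨g, g', hg', hgg', hdg⟩ := hpw j hj
    obtain ⟨G, hG1, hG2, hG3⟩ := exists_absolutelyContinuous_representative (hclt j hj) hg' hgg' hdg
      (ae_restrict_of_ae_restrict_of_subset (Ioo_subset_Icc_self.trans (hsub j hj)) hdδ)
    refine ⟨G, hG1, hG2, fun x hx y hy => ?_⟩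
    rw [hDint x (hsub j hj hx) y (hsub j hj hy)]
    refine intervalIntegral.integral_congr_ae ?_
    rw [ae_restrict_iff' measurableSet_Icc] at hG3
    filter_upwards [hG3] with s hs hsI
    exact hs (uIcc_subset_Icc hx hy (uIoc_subset_uIcc hsI))
  choose! G hGac hGδ hGD using hpiece
  set T : Set ℝ := (fun s => |D s|) '' Icc (0 : ℝ) L with hT
  have hTbdd : BddAbove T := isCompact_Icc.bddAbove_image hDc.abs
  have hTpos : 0 < sSup T := by
    obtain ⟨s, hs, hs0⟩ : ∃ s ∈ Icc (0 : ℝ) L, D s ≠ 0 := by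
      by_contra! hzero
      have hlt := hclt 0 hN
      have hD0 : ∀ s ∈ Icc (c 0) (c 1), D s = 0 := fun s hs => hzero s (hsub 0 hN hs)
      have hne : ∀ s ∈ Icc (c 0) (c 1), G 0 s ≠ 0 := fun s hs =>
        abs_pos.1 (hδ.trans_le (hGδ 0 hN s hs))
      have hGc : ContinuousOn (G 0) (Icc (c 0) (c 1)) := uIcc_of_le hlt.le ▸ (hGac 0 hN).continuousOn
      obtain ⟨m, hm⟩ := nonempty_Ioo.2 hlt
      have hnhds := Icc_mem_nhds hm.1 hm.2
      have hder : HasDerivAt (fun x => ∫ t in (c 0)..x, G 0 t) (G 0 m) m :=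
        intervalIntegral.integral_hasDerivAt_right
          ((hGc.mono (Icc_subset_Icc le_rfl hm.2.le)).intervalIntegrable_of_Icc hm.1.le)
          (hGc.stronglyMeasurableAtFilter_nhdsWithin measurableSet_Icc m |>.filter_mono
            (by rw [nhdsWithin_eq_nhds.2 hnhds]))
          (hGc.continuousAt hnhds)
      refine hne m (Ioo_subset_Icc_self hm)
        (hder.unique ((hasDerivAt_const m (0 : ℝ)).congr_of_eventuallyEq ?_))
      filter_upwards [hnhds] with x hx
      rw [← hGD 0 hN _ ⟨le_rfl, hlt.le⟩ x hx, hD0 x hx, hD0 _ ⟨le_rfl, hlt.le⟩, sub_zero]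
    exact (abs_pos.2 hs0).trans_le (le_csSup hTbdd ⟨s, hs, rfl⟩)
  have hφ1 : ContDiff ℝ 1 φ := hφsmooth.of_le (by exact_mod_cast le_top)
  obtain ⟨C₀, hC₀⟩ := exists_norm_integral_truncatedKernel_le hφ1 hφrange hφzero
  set K : ℝ := ∑ j ∈ Finset.range N,
    2 * (2 / δ + ∫ s in (c j)..(c (j + 1)), |deriv (fun t => (G j t)⁻¹) s|) with hK
  have hK0 : 0 ≤ K := by
    refine Finset.sum_nonneg fun j hj => ?_
    have := intervalIntegral.integral_nonneg (hclt j (Finset.mem_range.1 hj)).le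
      (μ := volume) (f := fun s => |deriv (fun t => (G j t)⁻¹) s|) fun _ _ => abs_nonneg _
    positivity
  have hC₀0 : 0 ≤ C₀ := by
    have := (norm_nonneg _).trans (hC₀ 1 1 1 one_ne_zero one_pos one_pos 0)
    simpa using this
  refine ⟨K * C₀ * max 1 (sSup T) + 1, by positivity, fun a ha ε hε => ?_⟩
  set R := min |a| (sSup T) with hR
  have ha0 : 0 < |a| := abs_pos.2 ha
  have hRpos : 0 < R := lt_min ha0 hTpos
  have hset : MeasurableSet {s ∈ Icc (0 : ℝ) L | ε < |D s|} := by
    obtain ⟨u, hu, hu'⟩ := continuousOn_iff'.1 hDc.abs (Ioi ε) isOpen_Ioi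
    have : {s ∈ Icc (0 : ℝ) L | ε < |D s|} = u ∩ Icc 0 L := by
      rw [← hu', inter_comm]; rfl
    rw [this]
    exact hu.measurableSet.inter measurableSet_Icc
  have hmain : ∫ s in {s ∈ Icc (0:ℝ) L | ε < |D s|}, Complex.exp (Complex.I * a / (4 * D s)) *
      ((φ (D s / R) / |D s| : ℝ) : ℂ) = ∫ s in (0 : ℝ)..L, truncatedKernel φ a R ε (D s) := by
    rw [intervalIntegral.integral_of_le hL.le, ← integral_Icc_eq_integral_Ioc,
      ← inter_eq_self_of_subset_right (sep_subset (Icc (0 : ℝ) L) fun s => ε < |D s|),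
      ← setIntegral_indicator hset]
    refine setIntegral_congr_fun measurableSet_Icc fun s hs => ?_
    by_cases h : ε < |D s|
    · rw [indicator_of_mem (show s ∈ {s ∈ Icc (0 : ℝ) L | ε < |D s|} from ⟨hs, h⟩),
        truncatedKernel_of_lt φ a R h]
    · rw [indicator_of_notMem (show s ∉ {s ∈ Icc (0 : ℝ) L | ε < |D s|} from fun h' => h h'.2),
        truncatedKernel_of_le φ a R (not_lt.1 h)]
  have hpieces := fun j (hj : j < N) => norm_integral_comp_le_of_norm_primitive_le (hclt j hj).le
    (measurable_truncatedKernel hφ1.continuous a R ε) (norm_truncatedKernel_le hφrange a R hε)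
    (Set.toFinite {ε, -ε}).countable
    (fun x hx => continuousAt_truncatedKernel hφ1.continuous a R hε hx)
    (hC₀ a R ε ha hRpos hε) (hDc.mono (hsub j hj)) (hGD j hj) (hGac j hj) hδ (hGδ j hj)
  have hratio : R / |a| ≤ max 1 (sSup T) / max |a| 1 := by
    rw [div_le_div_iff₀ ha0 (by positivity)]
    rcases le_total |a| 1 with h | h
    · rw [max_eq_right h, mul_one]
      nlinarith [min_le_left |a| (sSup T), le_max_left 1 (sSup T)]
    · rw [max_eq_left h]
      gcongr
      exact (min_le_right _ _).trans (le_max_right _ _)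
  rw [hmain]
  have hsum := intervalIntegral.sum_integral_adjacent_intervals fun j hj => (hpieces j hj).1
  rw [hc0, hcN] at hsum
  rw [← hsum]
  calc _ ≤ ∑ j ∈ Finset.range N, ‖∫ s in (c j)..(c (j + 1)), truncatedKernel φ a R ε (D s)‖ :=
        norm_sum_le _ _
    _ ≤ K * (C₀ * (R / |a|)) := by
      rw [hK, Finset.sum_mul]
      exact Finset.sum_le_sum fun j hj => (hpieces j (Finset.mem_range.1 hj)).2
    _ ≤ K * (C₀ * (max 1 (sSup T) / max |a| 1)) := by gcongr
    _ = K * C₀ * max 1 (sSup T) / max |a| 1 := by ring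
    _ ≤ _ := by gcongr; linarith
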